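/- arXiv:1902.03339 — 2 statements merged into one kernel-verified Lean document; each statement's English description precedes it below -/
import Mathlib

section
/- For every t ∈ {1, …, T} and every nonempty bounded set θ ⊆ ℝⁿ: for e ∈ {1, …, K}, the infimum over prescriptions in the definition of W_t(θ, e) is attained at one of the two constant prescriptions γ^all ≡ 1 or γ^none ≡ 0, and explicitly W_t(θ, e) = min( V_t({0}, e − 1), V_t(θ, e) ); for e = 0, W_t(θ, 0) = V_t(θ, 0). -/
noncomputable section

abbrev Euc (n : ℕ) := EuclideanSpace ℝ (Fin n)

variable {n : ℕ}

/-- Chebyshev radius of a set `S ⊆ ℝⁿ`: `r*(S) = inf_x sup_{y ∈ S} ‖y − x‖`. -/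
def rad {n : ℕ} (S : Set (Euc n)) : ℝ :=
  ⨅ x : Euc n, sSup {c : ℝ | ∃ y ∈ S, c = ‖y - x‖}

/-- `φ_a(S) = {λ A x + w : x ∈ S, ‖w‖ ≤ a}`. -/
def phiSet (lam : ℝ) (A : Euc n ≃ₗᵢ[ℝ] Euc n) (a : ℝ) (S : Set (Euc n)) :
    Set (Euc n) :=
  {z | ∃ x ∈ S, ∃ w : Euc n, ‖w‖ ≤ a ∧ z = lam • A x + w}

/-- `ψ(θ, γ, x) = {x}` if `γ(x) = 1, and `{z ∈ θ : γ(z) = 0}` if `γ(x) = 0`. -/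
def psiSet (θ : Set (Euc n)) (γ : Euc n → Bool) (x : Euc n) : Set (Euc n) :=
  if γ x then {x} else {z ∈ θ | γ z = false}

/-- The worst-case cost `sup_{x ∈ θ} V(ψ(θ, γ, x), e − γ(x))` of using
prescription `γ`, given the current value function `V`. -/
def prescCost (V : Set (Euc n) → ℕ → ℝ) (θ : Set (Euc n)) (e : ℕ)
    (γ : Euc n → Bool) : ℝ :=
  sSup {c : ℝ | ∃ x ∈ θ, c = V (psiSet θ γ x) (e - (if γ x then 1 else 0))}

/-- `W(θ, e)`: the infimum over prescriptions (required to be identically `0`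
when `e = 0`) of their worst-case cost, given the current value function `V`. -/
def Wfrom (V : Set (Euc n) → ℕ → ℝ) (θ : Set (Euc n)) (e : ℕ) : ℝ :=
  sInf {r : ℝ | ∃ γ : Euc n → Bool, (e = 0 → ∀ x, γ x = false) ∧
    r = prescCost V θ e γ}

/-- Value functions `V`, indexed by the number `k` of remaining steps, so that
`Vv lam A a T k` is `V_t` for the paper time `t = T − k`:
`V_T(π, e) = r*(π)` and `V_t(π, e) = max( r*(π), W_{t+1}(φ_{a_{t+1}}(π), e) )`
(0-indexed radii: `a i` is the paper's `a_{i+1}`). -/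
def Vv (lam : ℝ) (A : Euc n ≃ₗᵢ[ℝ] Euc n) (a : ℕ → ℝ) (T : ℕ) :
    ℕ → Set (Euc n) → ℕ → ℝ
  | 0 => fun π _ => rad π
  | k + 1 => fun π e =>
      max (rad π) (Wfrom (Vv lam A a T k) (phiSet lam A (a (T - 1 - k)) π) e)


/-- A value function is translation invariant if translating the set does not change its value. -/
def TranslationInvariant {n : ℕ} (V : Set (Euc n) → ℕ → ℝ) : Prop :=
  ∀ (v : Euc n) (S : Set (Euc n)) (e : ℕ), V ((· + v) '' S) e = V S e

lemma rad_image_add_right {n : ℕ} (v : Euc n) (S : Set (Euc n)) :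
    rad ((· + v) '' S) = rad S := by
  unfold rad
  refine ((Equiv.addRight v).iInf_congr fun x => ?_).symm
  congr 1
  ext c
  simp only [Set.mem_ofPred_eq, Set.exists_mem_image, Equiv.coe_addRight, add_sub_add_right_eq_sub]

lemma phiSet_image_add_right {n : ℕ} (lam : ℝ) (A : Euc n ≃ₗᵢ[ℝ] Euc n) (a : ℝ)
    (v : Euc n) (S : Set (Euc n)) :
    phiSet lam A a ((· + v) '' S) = (· + lam • A v) '' phiSet lam A a S := by
  ext z
  constructor
  · rintro ⟨_, ⟨x, hx, rfl⟩, w, hw, rfl⟩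
    refine ⟨lam • A x + w, ⟨x, hx, w, hw, rfl⟩, ?_⟩
    simp only [map_add, smul_add]
    abel
  · rintro ⟨_, ⟨x, hx, w, hw, rfl⟩, rfl⟩
    refine ⟨x + v, ⟨x, hx, rfl⟩, w, hw, ?_⟩
    simp only [map_add, smul_add]
    abel

lemma psiSet_image_add_right {n : ℕ} (v : Euc n) (θ : Set (Euc n)) (γ : Euc n → Bool)
    (x : Euc n) :
    psiSet ((· + v) '' θ) γ (x + v) = (· + v) '' psiSet θ (fun y => γ (y + v)) x := by
  unfold psiSet
  by_cases h : γ (x + v) = true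
  · simp [h]
  · simp only [h]
    ext z
    constructor
    · rintro ⟨⟨y, hy, rfl⟩, hz⟩
      exact ⟨y, ⟨hy, hz⟩, rfl⟩
    · rintro ⟨y, ⟨hy, hz⟩, rfl⟩
      exact ⟨⟨y, hy, rfl⟩, hz⟩

lemma TranslationInvariant.prescCost_image {n : ℕ} {V : Set (Euc n) → ℕ → ℝ}
    (hV : TranslationInvariant V) (v : Euc n) (θ : Set (Euc n)) (e : ℕ) (γ : Euc n → Bool) :
    prescCost V ((· + v) '' θ) e γ = prescCost V θ e (fun y => γ (y + v)) := by
  unfold prescCost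
  congr 1
  ext c
  simp only [Set.mem_ofPred_eq, Set.exists_mem_image, psiSet_image_add_right, hV v]

lemma TranslationInvariant.wfrom {n : ℕ} {V : Set (Euc n) → ℕ → ℝ}
    (hV : TranslationInvariant V) : TranslationInvariant (Wfrom V) := by
  intro v θ e
  unfold Wfrom
  congr 1
  ext r
  constructor
  · rintro ⟨γ, h, rfl⟩
    exact ⟨fun y => γ (y + v), fun he x => h he _, hV.prescCost_image v θ e γ⟩
  · rintro ⟨γ, h, rfl⟩
    refine ⟨fun y => γ (y - v), fun he x => h he _, ?_⟩
    simp only [hV.prescCost_image, add_sub_cancel_right]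

lemma translationInvariant_Vv {n : ℕ} (lam : ℝ) (A : Euc n ≃ₗᵢ[ℝ] Euc n) (a : ℕ → ℝ)
    (T k : ℕ) : TranslationInvariant (Vv lam A a T k) := by
  induction k with
  | zero => exact fun v S _ => rad_image_add_right v S
  | succ k ih =>
    intro v S e
    simp only [Vv, rad_image_add_right, phiSet_image_add_right, ih.wfrom _ _ e]

lemma TranslationInvariant.singleton {n : ℕ} {V : Set (Euc n) → ℕ → ℝ}
    (hV : TranslationInvariant V) (x : Euc n) (e : ℕ) : V {x} e = V {0} e := by
  simpa using hV x {0} e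

lemma prescCost_of_forall_eq {n : ℕ} {V : Set (Euc n) → ℕ → ℝ} {θ : Set (Euc n)}
    (hθ : θ.Nonempty) {e : ℕ} {γ : Euc n → Bool} {c : ℝ}
    (h : ∀ x ∈ θ, V (psiSet θ γ x) (e - (if γ x then 1 else 0)) = c) :
    prescCost V θ e γ = c := by
  have : {b : ℝ | ∃ x ∈ θ, b = V (psiSet θ γ x) (e - (if γ x then 1 else 0))} = {c} := by
    ext b
    constructor
    · rintro ⟨x, hx, rfl⟩
      exact h x hx
    · rintro rfl
      obtain ⟨x, hx⟩ := hθ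
      exact ⟨x, hx, (h x hx).symm⟩
  rw [prescCost, this, csSup_singleton]

lemma prescCost_of_forall_eq_false {n : ℕ} (V : Set (Euc n) → ℕ → ℝ) {θ : Set (Euc n)}
    (hθ : θ.Nonempty) (e : ℕ) {γ : Euc n → Bool} (h : ∀ x ∈ θ, γ x = false) :
    prescCost V θ e γ = V θ e := by
  refine prescCost_of_forall_eq hθ fun x hx => ?_
  have hsep : {z ∈ θ | γ z = false} = θ := Set.sep_eq_self_iff_mem_true.2 h
  simp [psiSet, h x hx, hsep]

lemma TranslationInvariant.prescCost_true {n : ℕ} {V : Set (Euc n) → ℕ → ℝ}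
    (hV : TranslationInvariant V) {θ : Set (Euc n)} (hθ : θ.Nonempty) (e : ℕ) :
    prescCost V θ e (fun _ => true) = V {0} (e - 1) :=
  prescCost_of_forall_eq hθ fun x _ => by simpa [psiSet] using hV.singleton x (e - 1)

lemma TranslationInvariant.le_prescCost {n : ℕ} {V : Set (Euc n) → ℕ → ℝ}
    (hV : TranslationInvariant V) {θ : Set (Euc n)} (e : ℕ) {γ : Euc n → Bool}
    {x : Euc n} (hx : x ∈ θ) (hγ : γ x = true) :
    V {0} (e - 1) ≤ prescCost V θ e γ := by
  refine le_csSup (Set.Finite.bddAbove ?_) ⟨x, hx, ?_⟩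
  · refine (Set.toFinite {V {0} (e - 1), V {z ∈ θ | γ z = false} e}).subset ?_
    rintro _ ⟨y, -, rfl⟩
    cases h : γ y
    · simp [psiSet, h]
    · simp [psiSet, h, hV.singleton y]
  · simp [psiSet, hγ, hV.singleton x]

lemma TranslationInvariant.wfrom_eq_min {n : ℕ} {V : Set (Euc n) → ℕ → ℝ}
    (hV : TranslationInvariant V) {θ : Set (Euc n)} (hθ : θ.Nonempty) {e : ℕ} (he : 1 ≤ e) :
    Wfrom V θ e = min (V {0} (e - 1)) (V θ e) := by
  refine IsLeast.csInf_eq ⟨?_, ?_⟩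
  · rcases min_choice (V {0} (e - 1)) (V θ e) with h | h <;> rw [h]
    · exact ⟨fun _ => true, by omega, (hV.prescCost_true hθ e).symm⟩
    · exact ⟨fun _ => false, fun _ _ => rfl,
        (prescCost_of_forall_eq_false V hθ e fun _ _ => rfl).symm⟩
  · rintro _ ⟨γ, -, rfl⟩
    by_cases h : ∀ x ∈ θ, γ x = false
    · exact (min_le_right _ _).trans_eq (prescCost_of_forall_eq_false V hθ e h).symm
    · push Not at h
      obtain ⟨x, hx, hγ⟩ := h
      exact (min_le_left _ _).trans (hV.le_prescCost e hx (by simpa using hγ))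

lemma wfrom_zero {n : ℕ} (V : Set (Euc n) → ℕ → ℝ) {θ : Set (Euc n)} (hθ : θ.Nonempty) :
    Wfrom V θ 0 = V θ 0 := by
  refine IsLeast.csInf_eq ⟨⟨fun _ => false, fun _ _ => rfl,
    (prescCost_of_forall_eq_false V hθ 0 fun _ _ => rfl).symm⟩, ?_⟩
  rintro _ ⟨γ, h, rfl⟩
  exact (prescCost_of_forall_eq_false V hθ 0 fun x _ => h rfl x).ge

/-- for every time `t` (0-indexed, `V_t = Vv lam A a T (T − 1 − t)`)
and every nonempty bounded `θ`: for `1 ≤ e ≤ K` the infimum in the definition of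
`W_t(θ, e)` is attained at one of the constant prescriptions `γ^all ≡ 1` or
`γ^none ≡ 0`, and `W_t(θ, e) = min( V_t({0}, e − 1), V_t(θ, e) )`; moreover
`W_t(θ, 0) = V_t(θ, 0)`. -/
theorem stmt8 {n : ℕ} (hn : 1 ≤ n) (lam : ℝ) (A : Euc n ≃ₗᵢ[ℝ] Euc n)
    (T K : ℕ) (hT : 1 ≤ T) (hK : 1 ≤ K)
    (a : ℕ → ℝ) (ha : ∀ t, 0 ≤ a t)
    (t : ℕ) (ht : t < T)
    (θ : Set (Euc n)) (hθ : θ.Nonempty) (hθb : Bornology.IsBounded θ) :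
    (∀ e, 1 ≤ e → e ≤ K →
      ((Wfrom (Vv lam A a T (T - 1 - t)) θ e =
          prescCost (Vv lam A a T (T - 1 - t)) θ e (fun _ => true) ∨
        Wfrom (Vv lam A a T (T - 1 - t)) θ e =
          prescCost (Vv lam A a T (T - 1 - t)) θ e (fun _ => false)) ∧
       Wfrom (Vv lam A a T (T - 1 - t)) θ e =
        min (Vv lam A a T (T - 1 - t) {(0 : Euc n)} (e - 1))
            (Vv lam A a T (T - 1 - t) θ e))) ∧
    Wfrom (Vv lam A a T (T - 1 - t)) θ 0 = Vv lam A a T (T - 1 - t) θ 0 := by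
  have hV := translationInvariant_Vv lam A a T (T - 1 - t)
  refine ⟨fun e he _ => ⟨?_, hV.wfrom_eq_min hθ he⟩, wfrom_zero _ hθ⟩
  rw [hV.wfrom_eq_min hθ he, hV.prescCost_true hθ,
    prescCost_of_forall_eq_false _ hθ e fun _ _ => rfl]
  exact min_choice _ _
end
end

section
/- For every t ∈ {1, …, T}, every e ∈ {0, …, K}, and all nonempty bounded sets π, θ ⊆ ℝⁿ: V_t(π, e) = Ṽ_t(r*(π), e) and W_t(θ, e) = W̃_t(r*(θ), e). -/
noncomputable section

variable {n : ℕ}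

/-- `W̃_t(r, e) = min( Ṽ_t(r, e), Ṽ_t(0, e−1) )` for `e > 0`, and
`W̃_t(r, 0) = Ṽ_t(r, 0)`, as an operation on the reduced value function `Ṽ_t`. -/
def tWfrom (tV : ℝ → ℕ → ℝ) (r : ℝ) (e : ℕ) : ℝ :=
  if e = 0 then tV r 0 else min (tV r e) (tV 0 (e - 1))

/-- Reduced value functions `Ṽ`, indexed by the number `k` of remaining steps
(`tVv lam a T k` is `Ṽ_t` for paper time `t = T − k`): `Ṽ_T(r, e) = r` and
`Ṽ_t(r, e) = max( r, W̃_{t+1}(|λ| r + a_{t+1}, e) )`. -/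
def tVv (lam : ℝ) (a : ℕ → ℝ) (T : ℕ) : ℕ → ℝ → ℕ → ℝ
  | 0 => fun r _ => r
  | k + 1 => fun r e => max r (tWfrom (tVv lam a T k) (|lam| * r + a (T - 1 - k)) e)

/-- The largest distance from `x` to a nonempty bounded set is a genuine supremum. -/
lemma isLUB_sSup_norm_sub {n : ℕ} {S : Set (Euc n)} (hS : S.Nonempty)
    (hb : Bornology.IsBounded S) (x : Euc n) :
    IsLUB {c : ℝ | ∃ y ∈ S, c = ‖y - x‖} (sSup {c : ℝ | ∃ y ∈ S, c = ‖y - x‖}) := by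
  obtain ⟨y, hy⟩ := hS
  refine isLUB_csSup ⟨_, y, hy, rfl⟩ ?_
  obtain ⟨C, hC⟩ := hb.exists_norm_le
  refine ⟨C + ‖x‖, ?_⟩
  rintro c ⟨z, hz, rfl⟩
  linarith [norm_sub_le z x, hC z hz]

lemma sSup_norm_sub_nonneg {n : ℕ} (S : Set (Euc n)) (x : Euc n) :
    0 ≤ sSup {c : ℝ | ∃ y ∈ S, c = ‖y - x‖} := by
  refine Real.sSup_nonneg ?_
  rintro c ⟨y, -, rfl⟩
  exact norm_nonneg _

lemma rad_le {n : ℕ} (S : Set (Euc n)) (x : Euc n) :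
    rad S ≤ sSup {c : ℝ | ∃ y ∈ S, c = ‖y - x‖} := by
  refine ciInf_le ⟨0, ?_⟩ x
  rintro _ ⟨z, rfl⟩
  exact sSup_norm_sub_nonneg S z

lemma rad_singleton {n : ℕ} (x : Euc n) : rad {x} = 0 := by
  refine le_antisymm ((rad_le {x} x).trans ?_) (le_ciInf fun z => sSup_norm_sub_nonneg _ z)
  refine Real.sSup_nonpos ?_
  rintro c ⟨y, rfl, rfl⟩
  simp

lemma phiSet_nonempty {n : ℕ} (lam : ℝ) (A : Euc n ≃ₗᵢ[ℝ] Euc n) {a : ℝ} (ha : 0 ≤ a)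
    {S : Set (Euc n)} (hS : S.Nonempty) : (phiSet lam A a S).Nonempty := by
  obtain ⟨x, hx⟩ := hS
  exact ⟨lam • A x + 0, x, hx, 0, by simpa using ha, rfl⟩

lemma isBounded_phiSet {n : ℕ} (lam : ℝ) (A : Euc n ≃ₗᵢ[ℝ] Euc n) (a : ℝ)
    {S : Set (Euc n)} (hb : Bornology.IsBounded S) :
    Bornology.IsBounded (phiSet lam A a S) := by
  obtain ⟨C, hC⟩ := hb.exists_norm_le
  refine isBounded_iff_forall_norm_le.2 ⟨|lam| * C + a, ?_⟩
  rintro z ⟨x, hx, w, hw, rfl⟩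
  refine (norm_add_le _ _).trans (add_le_add ?_ hw)
  rw [norm_smul, Real.norm_eq_abs, A.norm_map]
  exact mul_le_mul_of_nonneg_left (hC x hx) (abs_nonneg _)

lemma exists_norm_add_eq {E : Type*} [NormedAddCommGroup E] [NormedSpace ℝ E] [Nontrivial E]
    (v : E) {a : ℝ} (ha : 0 ≤ a) : ∃ w : E, ‖w‖ = a ∧ ‖v + w‖ = ‖v‖ + a := by
  by_cases hv : v = 0
  · obtain ⟨w, hw⟩ := exists_norm_eq E ha
    exact ⟨w, hw, by simp [hv, hw]⟩
  · have hw : ‖(a / ‖v‖) • v‖ = a := by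
      rw [norm_smul, Real.norm_eq_abs, abs_of_nonneg (by positivity)]
      exact div_mul_cancel₀ _ (norm_ne_zero_iff.2 hv)
    refine ⟨(a / ‖v‖) • v, hw, ?_⟩
    rw [(SameRay.sameRay_nonneg_smul_right v (by positivity)).norm_add, hw]

lemma sSup_norm_sub_phiSet {n : ℕ} (hn : 1 ≤ n) (lam : ℝ) (A : Euc n ≃ₗᵢ[ℝ] Euc n) {a : ℝ}
    (ha : 0 ≤ a) {S : Set (Euc n)} (hS : S.Nonempty) (hb : Bornology.IsBounded S)
    (x : Euc n) :
    sSup {c : ℝ | ∃ y ∈ phiSet lam A a S, c = ‖y - lam • A x‖} =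
      |lam| * sSup {c : ℝ | ∃ y ∈ S, c = ‖y - x‖} + a := by
  have : Nonempty (Fin n) := ⟨⟨0, hn⟩⟩
  have hS' := isLUB_sSup_norm_sub hS hb x
  have hφ := isLUB_sSup_norm_sub (phiSet_nonempty lam A ha hS) (isBounded_phiSet lam A a hb)
    (lam • A x)
  have hnorm : ∀ y, ‖lam • A y - lam • A x‖ = |lam| * ‖y - x‖ := fun y => by
    rw [← smul_sub, ← map_sub, norm_smul, Real.norm_eq_abs, A.norm_map]
  apply le_antisymm
  · refine hφ.2 ?_
    rintro c ⟨_, ⟨y, hy, w, hw, rfl⟩, rfl⟩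
    rw [add_sub_right_comm]
    refine (norm_add_le _ _).trans (add_le_add ?_ hw)
    rw [hnorm]
    exact mul_le_mul_of_nonneg_left (hS'.1 ⟨y, hy, rfl⟩) (abs_nonneg _)
  · have key : ∀ y ∈ S, |lam| * ‖y - x‖ + a ≤
        sSup {c : ℝ | ∃ y ∈ phiSet lam A a S, c = ‖y - lam • A x‖} := by
      intro y hy
      obtain ⟨w, hw, hvw⟩ := exists_norm_add_eq (lam • A y - lam • A x) ha
      rw [← hnorm, ← hvw]
      exact hφ.1 ⟨_, ⟨y, hy, w, hw.le, rfl⟩, by rw [add_sub_right_comm]⟩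
    rcases (abs_nonneg lam).eq_or_lt with h0 | hpos
    · obtain ⟨y, hy⟩ := hS
      simpa [← h0] using key y hy
    · rw [← le_sub_iff_add_le, ← le_div_iff₀' hpos]
      refine hS'.2 ?_
      rintro c ⟨y, hy, rfl⟩
      rw [le_div_iff₀' hpos, le_sub_iff_add_le]
      exact key y hy

/-- The Chebyshev radius after one noisy step is `|λ| r*(S) + a`. -/
lemma rad_phiSet {n : ℕ} (hn : 1 ≤ n) (lam : ℝ) (A : Euc n ≃ₗᵢ[ℝ] Euc n) {a : ℝ}
    (ha : 0 ≤ a) {S : Set (Euc n)} (hS : S.Nonempty) (hb : Bornology.IsBounded S) :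
    rad (phiSet lam A a S) = |lam| * rad S + a := by
  have : Nonempty (Fin n) := ⟨⟨0, hn⟩⟩
  apply le_antisymm
  · rw [← sub_le_iff_le_add, rad.eq_1 S, Real.mul_iInf_of_nonneg (abs_nonneg _)]
    refine le_ciInf fun x => ?_
    rw [sub_le_iff_le_add, ← sSup_norm_sub_phiSet hn lam A ha hS hb x]
    exact rad_le _ _
  · refine le_ciInf fun x => ?_
    by_cases hlam : lam = 0
    · subst hlam
      obtain ⟨y, hy⟩ := hS
      obtain ⟨w, hw, hvw⟩ := exists_norm_add_eq (-x) ha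
      have hφ := isLUB_sSup_norm_sub (phiSet_nonempty 0 A ha ⟨y, hy⟩)
        (isBounded_phiSet 0 A a hb) x
      have h1 : ‖-x + w‖ ≤ sSup {c : ℝ | ∃ y ∈ phiSet 0 A a S, c = ‖y - x‖} :=
        hφ.1 ⟨w, ⟨y, hy, w, hw.le, by simp⟩, by rw [neg_add_eq_sub]⟩
      rw [hvw] at h1
      rw [abs_zero, zero_mul, zero_add]
      exact (le_add_of_nonneg_left (norm_nonneg _)).trans h1
    · have hx : lam • A (A.symm (lam⁻¹ • x)) = x := by
        rw [A.apply_symm_apply, smul_inv_smul₀ hlam]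
      rw [← hx, sSup_norm_sub_phiSet hn lam A ha hS hb]
      gcongr
      exact rad_le _ _

lemma prescCost_of_forall_false {n : ℕ} (V : Set (Euc n) → ℕ → ℝ) {θ : Set (Euc n)}
    (hθ : θ.Nonempty) (e : ℕ) {γ : Euc n → Bool} (hγ : ∀ x ∈ θ, γ x = false) :
    prescCost V θ e γ = V θ e := by
  have hψ : {z ∈ θ | γ z = false} = θ := Set.sep_eq_self_iff_mem_true.2 hγ
  have hset : {c : ℝ | ∃ x ∈ θ, c = V (psiSet θ γ x) (e - (if γ x then 1 else 0))} =
      {V θ e} := by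
    ext c
    constructor
    · rintro ⟨x, hx, rfl⟩
      simp [psiSet, hγ x hx, hψ]
    · rintro rfl
      obtain ⟨x, hx⟩ := hθ
      exact ⟨x, hx, by simp [psiSet, hγ x hx, hψ]⟩
  rw [prescCost, hset, csSup_singleton]

lemma prescCost_const_true {n : ℕ} {V : Set (Euc n) → ℕ → ℝ} {θ : Set (Euc n)}
    (hθ : θ.Nonempty) (e : ℕ) {v : ℝ} (hv : ∀ x, V {x} (e - 1) = v) :
    prescCost V θ e (fun _ => true) = v := by
  obtain ⟨x, hx⟩ := hθ
  have hset : {c : ℝ | ∃ x ∈ θ, c = v} = {v} := by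
    ext c
    exact ⟨fun ⟨_, _, hc⟩ => hc, fun hc => ⟨x, hx, hc⟩⟩
  simp only [prescCost, psiSet, if_true, hv, hset, csSup_singleton]

lemma le_prescCost_of_apply_true {n : ℕ} {V : Set (Euc n) → ℕ → ℝ} {θ : Set (Euc n)}
    (e : ℕ) {v : ℝ} (hv : ∀ x, V {x} (e - 1) = v) {γ : Euc n → Bool}
    {x : Euc n} (hx : x ∈ θ) (hγ : γ x = true) : v ≤ prescCost V θ e γ := by
  refine le_csSup ⟨max v (V {z ∈ θ | γ z = false} e), ?_⟩ ⟨x, hx, by simp [psiSet, hγ, hv]⟩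
  rintro c ⟨z, -, rfl⟩
  cases hz : γ z <;> simp [psiSet, hz, hv]

/-- If `V` depends only on the Chebyshev radius, then so does `W`: transmitting either never or
always is optimal. -/
lemma Wfrom_eq_tWfrom {n : ℕ} {V : Set (Euc n) → ℕ → ℝ} {tV : ℝ → ℕ → ℝ}
    (hV : ∀ (S : Set (Euc n)) (e : ℕ), S.Nonempty → Bornology.IsBounded S →
      V S e = tV (rad S) e)
    {θ : Set (Euc n)} (hθ : θ.Nonempty) (hb : Bornology.IsBounded θ) (e : ℕ) :
    Wfrom V θ e = tWfrom tV (rad θ) e := by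
  have hv : ∀ x, V {x} (e - 1) = tV 0 (e - 1) := fun x => by
    rw [hV _ _ (Set.singleton_nonempty x) Bornology.isBounded_singleton, rad_singleton]
  have hfalse : prescCost V θ e (fun _ => false) = tV (rad θ) e := by
    rw [prescCost_of_forall_false V hθ e fun _ _ => rfl, hV _ _ hθ hb]
  rw [Wfrom, tWfrom]
  refine IsLeast.csInf_eq ?_
  split_ifs with he
  · subst he
    refine ⟨⟨_, fun _ _ => rfl, hfalse.symm⟩, ?_⟩
    rintro r ⟨γ, hγ, rfl⟩
    rw [prescCost_of_forall_false V hθ 0 fun x _ => hγ rfl x, hV _ _ hθ hb]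
  · constructor
    · rcases min_choice (tV (rad θ) e) (tV 0 (e - 1)) with h | h <;> rw [h]
      · exact ⟨_, fun _ _ => rfl, hfalse.symm⟩
      · exact ⟨_, fun h0 => absurd h0 he, (prescCost_const_true hθ e hv).symm⟩
    · rintro r ⟨γ, -, rfl⟩
      by_cases hγ : ∀ x ∈ θ, γ x = false
      · rw [prescCost_of_forall_false V hθ e hγ, hV _ _ hθ hb]
        exact min_le_left _ _
      · push Not at hγ
        obtain ⟨x, hx, hγx⟩ := hγ
        exact (min_le_right _ _).trans
          (le_prescCost_of_apply_true e hv hx (by simpa using hγx))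

lemma Vv_eq_tVv {n : ℕ} (hn : 1 ≤ n) (lam : ℝ) (A : Euc n ≃ₗᵢ[ℝ] Euc n) (T : ℕ)
    {a : ℕ → ℝ} (ha : ∀ t, 0 ≤ a t) (k : ℕ) (S : Set (Euc n)) (e : ℕ) (hS : S.Nonempty)
    (hb : Bornology.IsBounded S) : Vv lam A a T k S e = tVv lam a T k (rad S) e := by
  induction k generalizing S e with
  | zero => rfl
  | succ k ih =>
    simp only [Vv, tVv]
    rw [Wfrom_eq_tWfrom ih (phiSet_nonempty lam A (ha _) hS)
      (isBounded_phiSet lam A _ hb), rad_phiSet hn lam A (ha _) hS hb]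

/-- the value functions depend on the information state only through
its Chebyshev radius: `V_t(π, e) = Ṽ_t(r*(π), e)` and `W_t(θ, e) = W̃_t(r*(θ), e)`
for all nonempty bounded `π, θ` (paper time `t` 0-indexed as `t < T`). -/
theorem stmt9 {n : ℕ} (hn : 1 ≤ n) (lam : ℝ) (A : Euc n ≃ₗᵢ[ℝ] Euc n)
    (T K : ℕ) (hT : 1 ≤ T) (hK : 1 ≤ K)
    (a : ℕ → ℝ) (ha : ∀ t, 0 ≤ a t)
    (t e : ℕ) (ht : t < T) (he : e ≤ K)
    (π θ : Set (Euc n)) (hπ : π.Nonempty) (hθ : θ.Nonempty)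
    (hπb : Bornology.IsBounded π) (hθb : Bornology.IsBounded θ) :
    Vv lam A a T (T - 1 - t) π e = tVv lam a T (T - 1 - t) (rad π) e ∧
    Wfrom (Vv lam A a T (T - 1 - t)) θ e = tWfrom (tVv lam a T (T - 1 - t)) (rad θ) e := by
  exact ⟨Vv_eq_tVv hn lam A T ha _ π e hπ hπb,
    Wfrom_eq_tWfrom (Vv_eq_tVv hn lam A T ha _) hθ hθb e⟩
end
end
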